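/- arXiv:2110.15903 — 7 statements merged into one kernel-verified Lean document; each statement's English description precedes it below -/
import Mathlib

section
/- Let A be an associative unital ring and let I be a left ideal of A which does not annihilate any simple left A-module (that is, for every simple left A-module M one has I·M ≠ 0). Then the composite map I → A → A/[A,A] is surjective; equivalently, for every a ∈ A there exists i ∈ I such that a − i lies in [A,A]. -/
/-- The additive subgroup of a ring generated by all commutators `a * b - b * a`;
the quotient by it is the cocenter (zeroth Hochschild homology). -/
def commutatorAddSubgroup (B : Type*) [Ring B] : AddSubgroup B :=
  AddSubgroup.closure {x | ∃ a b : B, x = a * b - b * a}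

/-- A left ideal annihilating no simple module generates the unit two-sided ideal. -/
theorem span_mul_eq_top_of_not_annihilate_simple {A : Type u} [Ring A] (I : Ideal A)
    (h : ∀ (M : Type u) [AddCommGroup M] [Module A M], IsSimpleModule A M →
      ∃ x ∈ I, ∃ m : M, x • m ≠ 0) :
    Ideal.span {y : A | ∃ x ∈ I, ∃ b : A, y = x * b} = ⊤ := by
  by_contra hne
  obtain ⟨P, hP, hle⟩ := Ideal.exists_le_maximal _ hne
  obtain ⟨x, hx, m, hm⟩ := h (A ⧸ P) (isSimpleModule_iff_isCoatom.mpr hP.out)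
  obtain ⟨b, rfl⟩ := Submodule.Quotient.mk_surjective P m
  apply hm
  rw [← Submodule.Quotient.mk_smul, Submodule.Quotient.mk_eq_zero]
  exact hle (Ideal.subset_span ⟨x, hx, b, rfl⟩)

/-- Left multiples of elements of `I * A` are congruent to elements of `I` modulo commutators. -/
theorem exists_mem_sub_mem_commutatorAddSubgroup {A : Type*} [Ring A] (I : Ideal A) {y : A}
    (hy : y ∈ Ideal.span {y : A | ∃ x ∈ I, ∃ b : A, y = x * b}) :
    ∀ c : A, ∃ i ∈ I, c * y - i ∈ commutatorAddSubgroup A := by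
  induction hy using Submodule.span_induction with
  | mem y hy =>
    obtain ⟨x, hx, b, rfl⟩ := hy
    intro c
    refine ⟨b * c * x, I.mul_mem_left _ hx, AddSubgroup.subset_closure ⟨c * x, b, ?_⟩⟩
    simp only [mul_assoc]
  | zero => exact fun c => ⟨0, I.zero_mem, by simp⟩
  | add y z _ _ hy hz =>
    intro c
    obtain ⟨i, hi, hyi⟩ := hy c
    obtain ⟨j, hj, hzj⟩ := hz c
    refine ⟨i + j, I.add_mem hi hj, ?_⟩
    rw [mul_add, add_sub_add_comm]
    exact add_mem hyi hzj
  | smul a y _ hy =>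
    intro c
    simpa only [smul_eq_mul, mul_assoc] using hy (c * a)

/-- If a left ideal `I` of an associative unital ring `A` does not annihilate any
simple left `A`-module, then the composite `I → A → A/[A,A]` is surjective, i.e. every
element of `A` is congruent to an element of `I` modulo `[A,A]`. -/
theorem stmt0 {A : Type u} [Ring A] (I : Ideal A)
    (h : ∀ (M : Type u) [AddCommGroup M] [Module A M], IsSimpleModule A M →
      ∃ x ∈ I, ∃ m : M, x • m ≠ 0) :
    ∀ a : A, ∃ i ∈ I, a - i ∈ commutatorAddSubgroup A := by
  intro a
  have htop := span_mul_eq_top_of_not_annihilate_simple I h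
  simpa using exists_mem_sub_mem_commutatorAddSubgroup I
    (htop ▸ Submodule.mem_top : (1 : A) ∈ Ideal.span _) a
end

section
/- Let A be an associative unital ring, let I be a left ideal of A, and let 𝓘 be the two-sided ideal of A generated by I. Then the images of I and of 𝓘 under the quotient map A → A/[A,A] coincide. -/
/-- Elements of a two-sided ideal generated by a left ideal `I` are congruent to elements of `I`
modulo commutators. -/
theorem exists_mem_sub_mem_commutatorAddSubgroup_s1 {A : Type*} [Ring A] (I : Ideal A) {z : A}
    (hz : z ∈ TwoSidedIdeal.span (I : Set A)) :
    ∃ y ∈ I, -y + z ∈ commutatorAddSubgroup A := by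
  rw [TwoSidedIdeal.mem_span_iff_mem_addSubgroup_closure] at hz
  induction hz using AddSubgroup.closure_induction with
  | mem z hz =>
    obtain ⟨_, ⟨a, -, x, hx, rfl⟩, b, -, rfl⟩ := hz
    refine ⟨b * (a * x), I.mul_mem_left _ (I.mul_mem_left _ hx), ?_⟩
    exact AddSubgroup.subset_closure ⟨a * x, b, neg_add_eq_sub _ _⟩
  | zero => exact ⟨0, I.zero_mem, by simp [zero_mem]⟩
  | add z w _ _ hz hw =>
    obtain ⟨y, hy, hyz⟩ := hz
    obtain ⟨v, hv, hvw⟩ := hw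
    refine ⟨y + v, I.add_mem hy hv, ?_⟩
    convert add_mem hyz hvw using 1
    abel
  | neg z _ hz =>
    obtain ⟨y, hy, hyz⟩ := hz
    refine ⟨-y, I.neg_mem hy, ?_⟩
    convert neg_mem hyz using 1
    abel

/-- For a left ideal `I` of an associative unital ring `A`, the image of `I` in the
cocenter `A/[A,A]` coincides with the image of the two-sided ideal generated by `I`. -/
theorem stmt1 {A : Type*} [Ring A] (I : Ideal A) :
    (QuotientAddGroup.mk' (commutatorAddSubgroup A)) '' (I : Set A)
      = (QuotientAddGroup.mk' (commutatorAddSubgroup A)) ''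
          ((TwoSidedIdeal.span (I : Set A) : TwoSidedIdeal A) : Set A) := by
  apply (Set.image_mono TwoSidedIdeal.subset_span).antisymm
  rintro _ ⟨z, hz, rfl⟩
  obtain ⟨y, hy, hyz⟩ := exists_mem_sub_mem_commutatorAddSubgroup_s1 I hz
  exact ⟨y, hy, QuotientAddGroup.eq.mpr hyz⟩
end

section
/- The center of the ring A consists exactly of the scalar matrices f·1 with f an even polynomial in ℂ[x]; in particular the center of A is isomorphic as a ℂ-algebra to the polynomial ring ℂ[t] in one variable, via t ↦ x²·1. -/
open Polynomial

/-- The subalgebra `A ⊆ Mat₂(ℂ[x])` of matrices `(a_{ij})` with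
`a_{ij}(-x) = (-1)^{i-j} a_{ij}(x)`: diagonal entries even, off-diagonal entries odd. -/
noncomputable def cellRing : Subalgebra ℂ (Matrix (Fin 2) (Fin 2) (Polynomial ℂ)) where
  carrier := {M | ∀ i j, aeval (-X : Polynomial ℂ) (M i j)
      = (if i = j then 1 else -1) * M i j}
  mul_mem' := by
    intro M N hM hN
    simp only [Set.mem_setOf_eq] at hM hN ⊢
    intro i k
    have hs : ∀ i j k : Fin 2,
        (if i = j then (1 : Polynomial ℂ) else -1) * (if j = k then 1 else -1)
          = (if i = k then 1 else -1) := by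
      intro i j k
      fin_cases i <;> fin_cases j <;> fin_cases k <;> norm_num
    simp only [Matrix.mul_apply, map_sum, map_mul, Finset.mul_sum]
    refine Finset.sum_congr rfl fun j _ => ?_
    rw [hM i j, hN j k, ← hs i j k]
    ring
  one_mem' := by
    simp only [Set.mem_setOf_eq]
    intro i j
    by_cases h : i = j
    · subst h; simp
    · simp [Matrix.one_apply_ne h, h]
  add_mem' := by
    intro M N hM hN
    simp only [Set.mem_setOf_eq] at hM hN ⊢
    intro i j
    simp only [Matrix.add_apply, map_add, hM i j, hN i j, mul_add]
  zero_mem' := by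
    simp only [Set.mem_setOf_eq]
    intro i j
    simp
  algebraMap_mem' := by
    intro c
    simp only [Set.mem_setOf_eq]
    intro i j
    by_cases h : i = j
    · subst h; simp [Matrix.algebraMap_matrix_apply]
    · simp [Matrix.algebraMap_matrix_apply, h]

lemma exists_expand_two_eq_of_even {f : Polynomial ℂ}
    (hf : aeval (-X : Polynomial ℂ) f = f) : ∃ g, expand ℂ 2 g = f := by
  refine ⟨contract 2 f, ?_⟩
  ext n
  rw [coeff_expand two_pos, coeff_contract two_ne_zero]
  split_ifs with h
  · rw [Nat.div_mul_cancel h]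
  · have h1 := congrArg (fun q => coeff q n) hf
    have hodd : Odd n := by rwa [← Nat.not_even_iff_odd, even_iff_two_dvd]
    have hX : (-X : Polynomial ℂ) = C (-1) * X := by simp
    change (f.comp (-X)).coeff n = _ at h1
    rw [hX, comp_C_mul_X_coeff, hodd.neg_one_pow, mul_neg_one] at h1
    exact (self_eq_neg.mp h1.symm).symm

lemma smul_one_mem_cellRing {f : Polynomial ℂ} (hf : aeval (-X : Polynomial ℂ) f = f) :
    f • (1 : Matrix (Fin 2) (Fin 2) (Polynomial ℂ)) ∈ cellRing := by
  intro i j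
  by_cases h : i = j
  · subst h; simp [hf]
  · simp [Matrix.one_apply_ne h]

lemma diagonal_one_zero_mem_cellRing :
    (!![1, 0; 0, 0] : Matrix (Fin 2) (Fin 2) (Polynomial ℂ)) ∈ cellRing := by
  intro i j
  fin_cases i <;> fin_cases j <;> simp

lemma antidiagonal_X_mem_cellRing :
    (!![0, X; X, 0] : Matrix (Fin 2) (Fin 2) (Polynomial ℂ)) ∈ cellRing := by
  intro i j
  fin_cases i <;> fin_cases j <;> simp

lemma mem_center_cellRing_iff (M : cellRing) :
    M ∈ Subalgebra.center ℂ cellRing ↔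
      ∃ f : Polynomial ℂ, aeval (-X : Polynomial ℂ) f = f ∧
        (M : Matrix (Fin 2) (Fin 2) (Polynomial ℂ))
          = f • (1 : Matrix (Fin 2) (Fin 2) (Polynomial ℂ)) := by
  rw [Subalgebra.mem_center_iff]
  constructor
  · intro h
    have hE := congrArg Subtype.val (h ⟨_, diagonal_one_zero_mem_cellRing⟩)
    have hX := congrArg Subtype.val (h ⟨_, antidiagonal_X_mem_cellRing⟩)
    obtain ⟨M, hM⟩ := M
    simp only [MulMemClass.mk_mul_mk] at hE hX
    have h01 : M 0 1 = 0 := by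
      simpa [Matrix.mul_apply, Fin.sum_univ_two] using congrFun (congrFun hE 0) 1
    have h10 : M 1 0 = 0 := by
      simpa [Matrix.mul_apply, Fin.sum_univ_two] using (congrFun (congrFun hE 1) 0).symm
    have h11 : M 1 1 = M 0 0 := by
      have := congrFun (congrFun hX 0) 1
      simp only [Matrix.mul_apply, Fin.sum_univ_two] at this
      simp only [Matrix.of_apply, Matrix.cons_val_zero, Matrix.cons_val_one,
        Matrix.cons_val', Matrix.cons_val_fin_one, zero_mul, mul_zero, zero_add,
        add_zero] at this
      exact mul_left_cancel₀ X_ne_zero (this.trans (mul_comm _ _))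
    refine ⟨M 0 0, by simpa using hM 0 0, ?_⟩
    ext1 i j
    fin_cases i <;> fin_cases j <;> simp [h01, h10, h11]
  · rintro ⟨f, -, hM⟩ N
    apply Subtype.ext
    rw [MulMemClass.coe_mul, MulMemClass.coe_mul, hM]
    simp

/-- The central element `x² • 1` of `cellRing`. -/
noncomputable def centerGenerator : Subalgebra.center ℂ cellRing :=
  have hX : aeval (-X : Polynomial ℂ) (X ^ 2 : Polynomial ℂ) = X ^ 2 := by simp
  ⟨⟨(X ^ 2 : Polynomial ℂ) • 1, smul_one_mem_cellRing hX⟩,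
    (mem_center_cellRing_iff _).mpr ⟨X ^ 2, hX, rfl⟩⟩

lemma coe_aeval_centerGenerator (p : Polynomial ℂ) :
    (((aeval centerGenerator p : Subalgebra.center ℂ cellRing) : cellRing) :
        Matrix (Fin 2) (Fin 2) (Polynomial ℂ)) = expand ℂ 2 p • 1 := by
  have h : (cellRing.val.comp (Subalgebra.center ℂ cellRing).val).comp (aeval centerGenerator)
      = (Algebra.algHom ℂ (Polynomial ℂ) (Matrix (Fin 2) (Fin 2) (Polynomial ℂ))).comp
          (expand ℂ 2) := by
    apply Polynomial.algHom_ext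
    simp [centerGenerator, -map_pow]
    exact (Algebra.algebraMap_eq_smul_one _).symm
  rw [← Algebra.algebraMap_eq_smul_one]
  exact DFunLike.congr_fun h p

lemma aeval_centerGenerator_bijective :
    Function.Bijective (aeval (R := ℂ) centerGenerator) := by
  constructor
  · intro p q hpq
    have h : (expand ℂ 2 p • 1 : Matrix (Fin 2) (Fin 2) (Polynomial ℂ)) = expand ℂ 2 q • 1 := by
      rw [← coe_aeval_centerGenerator, ← coe_aeval_centerGenerator, hpq]
    have h00 := congrFun (congrFun h 0) 0
    simp only [Matrix.smul_apply, Matrix.one_apply_eq, smul_eq_mul, mul_one] at h00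
    exact expand_injective two_pos h00
  · intro z
    obtain ⟨f, hf, hz⟩ := (mem_center_cellRing_iff z).mp z.2
    obtain ⟨g, rfl⟩ := exists_expand_two_eq_of_even hf
    exact ⟨g, Subtype.ext (Subtype.ext ((coe_aeval_centerGenerator g).trans hz.symm))⟩

/-- The center of `A` consists exactly of the scalar matrices `f • 1` with `f` an even
polynomial, and is isomorphic as a ℂ-algebra to the polynomial ring `ℂ[t]` via
`t ↦ x² • 1`. -/
theorem stmt2 :
    (∀ M : cellRing, M ∈ Subalgebra.center ℂ cellRing ↔
      ∃ f : Polynomial ℂ, aeval (-X : Polynomial ℂ) f = f ∧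
        (M : Matrix (Fin 2) (Fin 2) (Polynomial ℂ))
          = f • (1 : Matrix (Fin 2) (Fin 2) (Polynomial ℂ))) ∧
    ∃ e : Polynomial ℂ ≃ₐ[ℂ] Subalgebra.center ℂ cellRing,
      (((e X : Subalgebra.center ℂ cellRing) : cellRing) :
          Matrix (Fin 2) (Fin 2) (Polynomial ℂ))
        = (X ^ 2 : Polynomial ℂ) • (1 : Matrix (Fin 2) (Fin 2) (Polynomial ℂ)) := by
  refine ⟨mem_center_cellRing_iff,
    AlgEquiv.ofBijective (aeval centerGenerator) aeval_centerGenerator_bijective, ?_⟩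
  rw [AlgEquiv.ofBijective_apply, coe_aeval_centerGenerator, expand_X]
end

section
/- The additive commutator subgroup [A,A] of the ring A equals the set of all matrices M ∈ A such that the trace of M is the zero polynomial and the constant term of the (0,0)-entry of M vanishes, i.e. [A,A] = { M ∈ A : tr M = 0 and (M₀₀)(0) = 0 }. -/
open Polynomial

theorem mem_cellRing_iff {M : Matrix (Fin 2) (Fin 2) ℂ[X]} :
    M ∈ cellRing ↔ ∀ i j, aeval (-X : ℂ[X]) (M i j) = (if i = j then 1 else -1) * M i j :=
  Iff.rfl

theorem of_mem_cellRing {a b c d : ℂ[X]} (ha : aeval (-X : ℂ[X]) a = a)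
    (hb : aeval (-X : ℂ[X]) b = -b) (hc : aeval (-X : ℂ[X]) c = -c)
    (hd : aeval (-X : ℂ[X]) d = d) : !![a, b; c, d] ∈ cellRing := by
  rw [mem_cellRing_iff]
  intro i j
  fin_cases i <;> fin_cases j <;> simp [ha, hb, hc, hd]

theorem eval_zero_eq_zero_of_odd {p : ℂ[X]} (hp : aeval (-X : ℂ[X]) p = -p) :
    p.eval 0 = 0 := by
  have h := congrArg (eval 0) hp
  rw [← comp_eq_aeval, eval_comp] at h
  simp only [eval_neg, eval_X, neg_zero] at h
  exact self_eq_neg.mp h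

theorem eval_zero_offDiag {M : Matrix (Fin 2) (Fin 2) ℂ[X]} (hM : M ∈ cellRing)
    {i j : Fin 2} (hij : i ≠ j) : (M i j).eval 0 = 0 :=
  eval_zero_eq_zero_of_odd <| by simpa [hij] using mem_cellRing_iff.mp hM i j

theorem commutator_mem_commutatorAddSubgroup {B : Type*} [Ring B] (a b : B) :
    a * b - b * a ∈ commutatorAddSubgroup B :=
  AddSubgroup.subset_closure ⟨a, b, rfl⟩

theorem trace_eq_zero_and_eval_zero_of_mem {M : cellRing}
    (hM : M ∈ commutatorAddSubgroup cellRing) :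
    Matrix.trace (M : Matrix (Fin 2) (Fin 2) ℂ[X]) = 0 ∧
      ((M : Matrix (Fin 2) (Fin 2) ℂ[X]) 0 0).eval 0 = 0 := by
  induction hM using AddSubgroup.closure_induction with
  | mem x hx =>
    obtain ⟨a, b, rfl⟩ := hx
    refine ⟨by simp [Matrix.trace_sub, Matrix.trace_mul_comm a.1], ?_⟩
    simp [Matrix.mul_apply, Fin.sum_univ_two, mul_comm,
      eval_zero_offDiag a.2 (zero_ne_one (α := Fin 2)),
      eval_zero_offDiag b.2 (zero_ne_one (α := Fin 2))]
  | zero => simp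
  | add x y _ _ hx hy => simp [Matrix.trace_add, hx.1, hy.1, hx.2, hy.2]
  | neg x _ hx => simp [Matrix.trace_neg, hx.1, hx.2]

theorem mem_commutatorAddSubgroup_of_trace_eq_zero {M : cellRing}
    (htr : Matrix.trace (M : Matrix (Fin 2) (Fin 2) ℂ[X]) = 0)
    (h0 : ((M : Matrix (Fin 2) (Fin 2) ℂ[X]) 0 0).eval 0 = 0) :
    M ∈ commutatorAddSubgroup cellRing := by
  obtain ⟨M, hM⟩ := M
  dsimp only at htr h0
  have hM' := mem_cellRing_iff.mp hM
  have hb : aeval (-X : ℂ[X]) (M 0 1) = -M 0 1 := by simpa using hM' 0 1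
  have hc : aeval (-X : ℂ[X]) (M 1 0) = -M 1 0 := by simpa using hM' 1 0
  have ha : aeval (-X : ℂ[X]) (M 0 0) = M 0 0 := by simpa using hM' 0 0
  have hd : M 1 1 = -M 0 0 := by
    rw [Matrix.trace_fin_two] at htr
    exact eq_neg_of_add_eq_zero_right htr
  obtain ⟨q, hq⟩ : X ∣ M 0 0 := by rwa [X_dvd_iff, coeff_zero_eq_eval_zero]
  have hq' : aeval (-X : ℂ[X]) q = -q := by
    rw [hq, map_mul, aeval_X] at ha
    refine mul_left_cancel₀ (X_ne_zero (R := ℂ)) ?_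
    linear_combination -ha
  let e : cellRing := ⟨!![1, 0; 0, 0], of_mem_cellRing (by simp) (by simp) (by simp) (by simp)⟩
  let u (p : ℂ[X]) (hp : aeval (-X : ℂ[X]) p = -p) : cellRing :=
    ⟨!![0, p; 0, 0], of_mem_cellRing (by simp) hp (by simp) (by simp)⟩
  let l (p : ℂ[X]) (hp : aeval (-X : ℂ[X]) p = -p) : cellRing :=
    ⟨!![0, 0; p, 0], of_mem_cellRing (by simp) (by simp) hp (by simp)⟩
  have hX : aeval (-X : ℂ[X]) (X : ℂ[X]) = -X := aeval_X _
  have key : (⟨M, hM⟩ : cellRing) = (e * u _ hb - u _ hb * e) + (l _ hc * e - e * l _ hc)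
      + (u X hX * l q hq' - l q hq' * u X hX) := by
    ext1
    ext1 i j
    fin_cases i <;> fin_cases j <;> simp [e, u, l, hd, hq, mul_comm]
  rw [key]
  exact add_mem (add_mem (commutator_mem_commutatorAddSubgroup _ _)
    (commutator_mem_commutatorAddSubgroup _ _)) (commutator_mem_commutatorAddSubgroup _ _)

/-- `[A,A]` consists exactly of the matrices `M ∈ A` with `tr M = 0` and vanishing
constant term of the `(0,0)`-entry. -/
theorem stmt3 :
    ∀ M : cellRing, M ∈ commutatorAddSubgroup cellRing ↔
      Matrix.trace (M : Matrix (Fin 2) (Fin 2) (Polynomial ℂ)) = 0 ∧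
      Polynomial.eval 0 ((M : Matrix (Fin 2) (Fin 2) (Polynomial ℂ)) 0 0) = 0 := by
  exact fun _ => ⟨trace_eq_zero_and_eval_zero_of_mem,
    fun h => mem_commutatorAddSubgroup_of_trace_eq_zero h.1 h.2⟩
end

section
/- The cocenter A/[A,A] is not a torsion-free module over the center of A. Explicitly, the matrix diag(1, −1) does not lie in [A,A], but its product with the nonzero central element x²·1 does: x²·diag(1, −1) ∈ [A,A]. -/
open Polynomial

/-- An odd off-diagonal entry vanishes at the origin. -/
theorem cellRing_eval_zero_of_ne (M : cellRing) {i j : Fin 2} (h : i ≠ j) :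
    (M.1 i j).eval 0 = 0 := by
  have h1 := congrArg (eval 0) (M.2 i j)
  rw [if_neg h, ← comp_eq_aeval, eval_comp] at h1
  simp only [eval_neg, eval_X, neg_zero, neg_mul, one_mul] at h1
  exact self_eq_neg.mp h1

/-- Evaluating the upper left entry at the origin kills every commutator. -/
theorem eval_zero_eq_zero_of_mem_commutatorAddSubgroup {M : cellRing}
    (hM : M ∈ commutatorAddSubgroup cellRing) : (M.1 0 0).eval 0 = 0 := by
  induction hM using AddSubgroup.closure_induction with
  | mem x hx =>
    obtain ⟨a, b, rfl⟩ := hx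
    have ha := cellRing_eval_zero_of_ne a (i := 0) (j := 1) (by decide)
    have hb := cellRing_eval_zero_of_ne b (i := 0) (j := 1) (by decide)
    simp [Matrix.mul_apply, Fin.sum_univ_two, ha, hb, mul_comm]
  | zero => simp
  | add x y _ _ hx hy => simp [hx, hy]
  | neg x _ hx => simp [hx]

/-- The cocenter `A/[A,A]` is not torsion-free over the center of `A`: the matrix
`diag(1,−1)` does not lie in `[A,A]`, but its product with the nonzero central element
`x² • 1` does. -/
theorem stmt5 :
    ∃ D Z : cellRing,
      (D : Matrix (Fin 2) (Fin 2) (Polynomial ℂ)) = Matrix.diagonal ![1, -1] ∧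
      (Z : Matrix (Fin 2) (Fin 2) (Polynomial ℂ))
          = (X ^ 2 : Polynomial ℂ) • (1 : Matrix (Fin 2) (Fin 2) (Polynomial ℂ)) ∧
      Z ∈ Subalgebra.center ℂ cellRing ∧ Z ≠ 0 ∧
      D ∉ commutatorAddSubgroup cellRing ∧
      Z * D ∈ commutatorAddSubgroup cellRing := by
  have hmem : ∀ M : Matrix (Fin 2) (Fin 2) (Polynomial ℂ),
      (∀ i j, aeval (-X : Polynomial ℂ) (M i j) = (if i = j then 1 else -1) * M i j) →
      M ∈ cellRing := fun _ h => h
  refine ⟨⟨Matrix.diagonal ![1, -1], hmem _ ?_⟩,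
    ⟨(X ^ 2 : Polynomial ℂ) • (1 : Matrix (Fin 2) (Fin 2) (Polynomial ℂ)), hmem _ ?_⟩,
    rfl, rfl, ?_, ?_, ?_, ?_⟩
  · intro i j
    fin_cases i <;> fin_cases j <;> simp
  · intro i j
    fin_cases i <;> fin_cases j <;> simp
  · rw [Subalgebra.mem_center_iff]
    intro b
    ext1
    simp
  · intro h
    have h00 := congrFun (congrFun (congrArg Subtype.val h) 0) 0
    simp at h00
  · intro h
    simpa using eval_zero_eq_zero_of_mem_commutatorAddSubgroup h
  · refine AddSubgroup.subset_closure
      ⟨⟨!![0, X; 0, 0], hmem _ ?_⟩, ⟨!![0, 0; X, 0], hmem _ ?_⟩, ?_⟩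
    · intro i j
      fin_cases i <;> fin_cases j <;> simp
    · intro i j
      fin_cases i <;> fin_cases j <;> simp
    · ext1
      ext1 i j
      fin_cases i <;> fin_cases j <;> simp [sq]
end

section
/- Let S be a finite-dimensional semisimple ℂ-algebra and let R be a commutative ℂ-algebra. Then the cocenter (S ⊗_ℂ R)/[S ⊗_ℂ R, S ⊗_ℂ R] is a free module of rank one over the center of S ⊗_ℂ R. -/
open TensorProduct

theorem map_mem_commutatorAddSubgroup {A B : Type*} [Ring A] [Ring B] (f : A →+ B)
    (hf : ∀ a b, f (a * b) = f a * f b) {x : A} (hx : x ∈ commutatorAddSubgroup A) :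
    f x ∈ commutatorAddSubgroup B := by
  have hle : commutatorAddSubgroup A ≤ (commutatorAddSubgroup B).comap f := by
    refine (AddSubgroup.closure_le _).2 ?_
    rintro _ ⟨a, b, rfl⟩
    exact AddSubgroup.subset_closure ⟨f a, f b, by simp [hf]⟩
  exact hle hx

theorem mem_commutatorAddSubgroup_pi_iff {ι : Type*} [Finite ι] {B : ι → Type*}
    [∀ i, Ring (B i)] {x : ∀ i, B i} :
    x ∈ commutatorAddSubgroup (∀ i, B i) ↔ ∀ i, x i ∈ commutatorAddSubgroup (B i) := by
  classical
  have := Fintype.ofFinite ι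
  refine ⟨fun hx i => map_mem_commutatorAddSubgroup (Pi.evalAddMonoidHom B i) (fun _ _ => rfl) hx,
    fun hx => ?_⟩
  rw [← Finset.univ_sum_single x]
  exact sum_mem fun i _ => map_mem_commutatorAddSubgroup (AddMonoidHom.single B i)
    (fun a b => Pi.single_mul i a b) (hx i)

theorem Matrix.mem_commutatorAddSubgroup_iff {n R : Type*} [Fintype n] [DecidableEq n]
    [Nonempty n] [CommRing R] {x : Matrix n n R} :
    x ∈ commutatorAddSubgroup (Matrix n n R) ↔ x.trace = 0 := by
  constructor
  · intro hx
    have hle : commutatorAddSubgroup (Matrix n n R) ≤ (Matrix.traceAddMonoidHom n R).ker := by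
      refine (AddSubgroup.closure_le _).2 ?_
      rintro _ ⟨a, b, rfl⟩
      simp [AddMonoidHom.mem_ker, Matrix.trace_mul_comm a b]
    exact hle hx
  · intro hx
    obtain ⟨k⟩ := ‹Nonempty n›
    have key : x = ∑ i, ∑ j, (single i k (x i j) * single k j 1 -
        single k j 1 * single i k (x i j)) := by
      have h : ∀ i, ∑ j, single k j (1 : R) * single i k (x i j) = single k k (x i i) := by
        intro i
        rw [Finset.sum_eq_single i]
        · simp
        · intro j _ hj
          exact single_mul_single_of_ne _ _ _ _ hj _
        · simp
      simp_rw [Finset.sum_sub_distrib, h, single_mul_single_same, mul_one]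
      rw [← matrix_eq_sum_single]
      have ht : ∑ i, single k k (x i i) = single k k x.trace :=
        (map_sum (singleAddMonoidHom (α := R) k k) _ _).symm
      rw [ht, hx, single_zero, sub_zero]
    rw [key]
    exact sum_mem fun i _ => sum_mem fun j _ => AddSubgroup.subset_closure ⟨_, _, rfl⟩

/-- The cocenter of `B` is free of rank one over the center of `B`, generated by the class
of `b`. -/
def IsCocenterGenerator {B : Type*} [Ring B] (b : B) : Prop :=
  ∀ x : B, ∃! z : B, z ∈ Subring.center B ∧ x - z * b ∈ commutatorAddSubgroup B

namespace IsCocenterGenerator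

theorem bijective {B : Type*} [Ring B] {b : B} (h : IsCocenterGenerator b) :
    Function.Bijective (fun z : Subring.center B =>
      QuotientAddGroup.mk' (commutatorAddSubgroup B) ((z : B) * b)) := by
  rw [Function.bijective_iff_existsUnique]
  intro y
  obtain ⟨x, rfl⟩ := QuotientAddGroup.mk'_surjective _ y
  have hxz (z : B) : QuotientAddGroup.mk' (commutatorAddSubgroup B) (z * b) =
      QuotientAddGroup.mk' (commutatorAddSubgroup B) x ↔
      x - z * b ∈ commutatorAddSubgroup B := by
    simp [QuotientAddGroup.eq, sub_eq_neg_add]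
  simp_rw [hxz]
  obtain ⟨z, ⟨hz, hx⟩, huniq⟩ := h x
  exact ⟨⟨z, hz⟩, hx, fun w hw => Subtype.ext (huniq w ⟨w.2, hw⟩)⟩

theorem map_ringEquiv {A B : Type*} [Ring A] [Ring B] (e : A ≃+* B) {a : A}
    (h : IsCocenterGenerator a) : IsCocenterGenerator (e a) := by
  have hcenter (z : A) : e z ∈ Subring.center B ↔ z ∈ Subring.center A := by
    simp only [Subring.mem_center_iff, e.surjective.forall, ← map_mul, e.injective.eq_iff]
  have hcomm (x : A) : e x ∈ commutatorAddSubgroup B ↔ x ∈ commutatorAddSubgroup A :=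
    ⟨fun hx => by
      simpa using map_mem_commutatorAddSubgroup (e.symm : B →+ A) (map_mul e.symm) hx,
    fun hx => map_mem_commutatorAddSubgroup (e : A →+ B) (map_mul e) hx⟩
  rw [IsCocenterGenerator, e.surjective.forall]
  intro x
  rw [e.bijective.existsUnique_iff]
  simpa only [← map_mul, ← map_sub, hcenter, hcomm] using h x

theorem pi {ι : Type*} [Finite ι] {B : ι → Type*} [∀ i, Ring (B i)] {b : ∀ i, B i}
    (h : ∀ i, IsCocenterGenerator (b i)) : IsCocenterGenerator b := by
  have hcenter (z : ∀ i, B i) :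
      z ∈ Subring.center (∀ i, B i) ↔ ∀ i, z i ∈ Subring.center (B i) := by
    change z ∈ Set.center (∀ i, B i) ↔ ∀ i, z i ∈ Set.center (B i)
    simp [Set.center_pi]
  intro x
  choose z hz huniq using fun i => h i (x i)
  refine ⟨z, ⟨(hcenter z).2 fun i => (hz i).1,
    mem_commutatorAddSubgroup_pi_iff.2 fun i => (hz i).2⟩, fun w hw => funext fun i => ?_⟩
  exact huniq i (w i) ⟨(hcenter w).1 hw.1 i, mem_commutatorAddSubgroup_pi_iff.1 hw.2 i⟩

theorem matrix_single {n R : Type*} [Fintype n] [DecidableEq n] [CommRing R] (k : n) :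
    IsCocenterGenerator (Matrix.single k k (1 : R)) := by
  have : Nonempty n := ⟨k⟩
  have hcenter (z : Matrix n n R) :
      z ∈ Subring.center (Matrix n n R) ↔ ∃ r, Matrix.scalar n r = z := by
    change z ∈ Set.center (Matrix n n R) ↔ _
    simp
  have htrace (r : R) : (Matrix.scalar n r * Matrix.single k k 1).trace = r := by
    simp [Matrix.trace_mul_single]
  intro x
  simp only [Matrix.mem_commutatorAddSubgroup_iff, hcenter, Matrix.trace_sub, sub_eq_zero]
  refine ⟨Matrix.scalar n x.trace, ⟨⟨_, rfl⟩, (htrace _).symm⟩, ?_⟩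
  rintro _ ⟨⟨r, rfl⟩, hr⟩
  rw [hr, htrace]

end IsCocenterGenerator

/-- For a finite-dimensional semisimple ℂ-algebra `S` and a commutative ℂ-algebra `R`,
the cocenter of `S ⊗[ℂ] R` is a free module of rank one over the center of `S ⊗[ℂ] R`:
there is an element whose class generates the cocenter freely, i.e. such that
`z ↦ [z * b₀]` is a bijection from the center onto the cocenter. -/
theorem stmt6 (S : Type*) [Ring S] [Algebra ℂ S] [FiniteDimensional ℂ S]
    [IsSemisimpleRing S] (R : Type*) [CommRing R] [Algebra ℂ R] :
    ∃ b₀ : S ⊗[ℂ] R,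
      Function.Bijective (fun z : Subring.center (S ⊗[ℂ] R) =>
        QuotientAddGroup.mk' (commutatorAddSubgroup (S ⊗[ℂ] R)) ((z : S ⊗[ℂ] R) * b₀)) := by
  obtain ⟨n, d, hd, ⟨e⟩⟩ := IsSemisimpleRing.exists_algEquiv_pi_matrix_of_isAlgClosed ℂ S
  let f : S ⊗[ℂ] R ≃ₐ[ℂ] ∀ i, Matrix (Fin (d i)) (Fin (d i)) R :=
    (Algebra.TensorProduct.comm ℂ S R).trans <|
      (Algebra.TensorProduct.congr .refl e).trans <|
        (Algebra.TensorProduct.piRight ℂ ℂ R _).trans <|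
          .piCongrRight fun i => (matrixEquivTensor (Fin (d i)) ℂ R).symm
  exact ⟨_, ((IsCocenterGenerator.pi fun i =>
    IsCocenterGenerator.matrix_single (0 : Fin (d i))).map_ringEquiv
      f.symm.toRingEquiv).bijective⟩
end

section
/- There is no finite-dimensional semisimple ℂ-algebra S such that A is isomorphic as a ℂ-algebra to S ⊗_ℂ ℂ[t], where ℂ[t] is the polynomial ring in one variable over ℂ. -/
open Polynomial

open TensorProduct

/-- An element of `cellRing` from two even diagonal and two odd off-diagonal entries. -/
noncomputable def cellRingMk (a b c d : ℂ[X]) (ha : aeval (-X : ℂ[X]) a = a)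
    (hb : aeval (-X : ℂ[X]) b = -b) (hc : aeval (-X : ℂ[X]) c = -c)
    (hd : aeval (-X : ℂ[X]) d = d) : cellRing :=
  ⟨!![a, b; c, d], by
    change ∀ i j, _
    intro i j
    fin_cases i <;> fin_cases j <;> simp [ha, hb, hc, hd]⟩

theorem Polynomial.exists_odd_of_even {p : ℂ[X]} (hp : aeval (-X : ℂ[X]) p = p) :
    ∃ r : ℂ[X], aeval (-X : ℂ[X]) r = -r ∧ p = C (p.coeff 0) + r * X := by
  have h := p.divX_mul_X_add
  refine ⟨p.divX, ?_, by rw [add_comm, h]⟩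
  rw [← h] at hp
  simp only [map_add, map_mul, aeval_X, aeval_C, algebraMap_eq] at hp
  refine mul_right_cancel₀ (X_ne_zero : (X : ℂ[X]) ≠ 0) ?_
  linear_combination -hp

/-- A character of `cellRing` kills the element with both off-diagonal entries `X`. -/
theorem cellRing_character_antidiagonal (χ : cellRing →ₐ[ℂ] ℂ) :
    χ (cellRingMk 0 X X 0 (by simp) (by simp) (by simp) (by simp)) = 0 := by
  set u := cellRingMk 0 X 0 0 (by simp) (by simp) (by simp) (by simp)
  set v := cellRingMk 0 0 X 0 (by simp) (by simp) (by simp) (by simp)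
  have hu : u * u = 0 := Subtype.ext (Matrix.ext fun i j => by
    fin_cases i <;> fin_cases j <;> simp [u, cellRingMk])
  have hv : v * v = 0 := Subtype.ext (Matrix.ext fun i j => by
    fin_cases i <;> fin_cases j <;> simp [v, cellRingMk])
  have huv : cellRingMk 0 X X 0 (by simp) (by simp) (by simp) (by simp) = u + v :=
    Subtype.ext (by simp [u, v, cellRingMk])
  have hu' := congrArg χ hu
  have hv' := congrArg χ hv
  simp only [map_mul, map_zero, mul_self_eq_zero] at hu' hv'
  rw [huv, map_add, hu', hv', add_zero]

/-- All characters of `cellRing` take the same value on a central element. -/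
theorem cellRing_character_central (χ : cellRing →ₐ[ℂ] ℂ) (z : cellRing)
    (hz : ∀ w, z * w = w * z) : χ z = (z.1 0 0).coeff 0 := by
  set v := cellRingMk 0 X X 0 (by simp) (by simp) (by simp) (by simp) with hv
  set e := cellRingMk 1 0 0 0 (by simp) (by simp) (by simp) (by simp) with he
  have hze := congrArg Subtype.val (hz e)
  have hzv := congrArg Subtype.val (hz v)
  have h01 : z.1 0 1 = 0 := by
    simpa [he, cellRingMk, Matrix.mul_apply, eq_comm] using congrFun₂ hze 0 1
  have h10 : z.1 1 0 = 0 := by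
    simpa [he, cellRingMk, Matrix.mul_apply] using congrFun₂ hze 1 0
  have h11 : z.1 1 1 = z.1 0 0 := by
    have h := congrFun₂ hzv 1 0
    simp only [hv, cellRingMk, MulMemClass.coe_mul, Matrix.mul_apply, Fin.sum_univ_two,
      Matrix.of_apply, Matrix.cons_val_zero, Matrix.cons_val_one, mul_zero, zero_mul, zero_add,
      add_zero] at h
    refine mul_right_cancel₀ (X_ne_zero : (X : ℂ[X]) ≠ 0) ?_
    rw [h, mul_comm]
  obtain ⟨r, hr, hzr⟩ := exists_odd_of_even (by simpa using z.2 0 0)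
  have hz' : z = algebraMap ℂ cellRing ((z.1 0 0).coeff 0) +
      cellRingMk 0 r r 0 (by simp) hr hr (by simp) * v := by
    refine Subtype.ext (Matrix.ext fun i j => ?_)
    fin_cases i <;> fin_cases j <;>
      simp [h01, h10, h11, hv, cellRingMk, Matrix.algebraMap_matrix_apply] <;>
      exact hzr
  conv_lhs => rw [hz']
  rw [map_add, map_mul, cellRing_character_antidiagonal, mul_zero, add_zero, AlgHom.commutes]
  rfl

/-- Evaluation at `0` of the upper left entry. -/
noncomputable def cellRingCharacter : cellRing →ₐ[ℂ] ℂ :=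
  AlgHom.ofLinearMap
    { toFun := fun M => (M.1 0 0).eval 0
      map_add' := fun M N => by simp
      map_smul' := fun c M => by simp }
    (by simp)
    (fun M N => by
      have h := congrArg (eval 0) (M.2 0 1)
      simp only [aeval_def, algebraMap_eq, ← comp.eq_1, eval_comp] at h
      have h0 : (M.1 0 1).eval 0 = 0 := by
        simp at h
        linear_combination h / 2
      simp [Matrix.mul_apply, h0])

/-- There is no finite-dimensional semisimple ℂ-algebra `S` with `A ≅ S ⊗[ℂ] ℂ[t]`
as ℂ-algebras. -/
theorem stmt7 (S : Type*) [Ring S] [Algebra ℂ S] [FiniteDimensional ℂ S]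
    [IsSemisimpleRing S] :
    IsEmpty (cellRing ≃ₐ[ℂ] (S ⊗[ℂ] Polynomial ℂ)) := by
  refine ⟨fun φ => ?_⟩
  let ψ (c : ℂ) : S ⊗[ℂ] ℂ[X] →ₐ[ℂ] ℂ :=
    Algebra.TensorProduct.lift
      ((cellRingCharacter.comp φ.symm.toAlgHom).comp Algebra.TensorProduct.includeLeft)
      (aeval c) (fun _ _ => Commute.all _ _)
  have hψ (c : ℂ) : ψ c (1 ⊗ₜ X) = c := by
    rw [Algebra.TensorProduct.lift_tmul, map_one, one_mul, aeval_X]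
  have hcomm (w : S ⊗[ℂ] ℂ[X]) : (1 ⊗ₜ X) * w = w * (1 ⊗ₜ X) := by
    induction w with
    | zero => simp
    | tmul s p => simp [mul_comm]
    | add a b ha hb => rw [mul_add, add_mul, ha, hb]
  have hz (w : cellRing) : φ.symm (1 ⊗ₜ X) * w = w * φ.symm (1 ⊗ₜ X) :=
    φ.injective (by simp [hcomm])
  have key (c : ℂ) : c = ((φ.symm (1 ⊗ₜ X)).1 0 0).coeff 0 := by
    rw [← cellRing_character_central ((ψ c).comp φ.toAlgHom) _ hz]
    simp [hψ]
  exact zero_ne_one ((key 0).trans (key 1).symm)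
end
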